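/- arXiv:1903.04009 — 2 statements merged into one kernel-verified Lean document; each statement's English description precedes it below -/
import Mathlib

section
/- Fix 1 ≤ p < ∞ and W ∈ 𝕎, and write 1_i for the indicator function of the interval (i-1, i] for i ∈ ℕ. The sequence (1_i)_{i=1}^∞ is 1-subsymmetric in G_{W,p}(0,∞): for every finitely supported real sequence (a_k)_{k=1}^∞ and every strictly increasing map k ↦ i_k from ℕ to ℕ, ρ_G(|∑_{k=1}^∞ a_k 1_{i_k}|) = ρ_G(|∑_{k=1}^∞ a_k 1_k|). -/
open MeasureTheory Set ENNReal Filter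

/-- An MO-isomorphism between subsets `E, F` of `ℝ`: a strictly increasing bijection from `E`
onto `F` such that both it and its inverse are measure-preserving for Lebesgue measure. -/
structure MOIso (E F : Set ℝ) (m : ℝ → ℝ) : Prop where
  bijOn : Set.BijOn m E F
  strictMonoOn : StrictMonoOn m E
  measPres : ∀ A : Set ℝ, A ⊆ F → NullMeasurableSet A volume →
    NullMeasurableSet (E ∩ m ⁻¹' A) volume ∧ volume (E ∩ m ⁻¹' A) = volume A
  invMeasPres : ∀ B : Set ℝ, B ⊆ E → NullMeasurableSet B volume →
    NullMeasurableSet (m '' B) volume ∧ volume (m '' B) = volume B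

/-- The class `𝕎` of weights: nonincreasing Lebesgue-measurable `W : (0,∞) → (0,∞)` with
`W(t) → 0` as `t → ∞`, `∫_0^∞ W = ∞` and `∫_0^1 W < ∞`. -/
def memW (W : ℝ → ℝ) : Prop :=
  AntitoneOn W (Ioi 0) ∧ (∀ t ∈ Ioi (0:ℝ), 0 < W t) ∧ AEMeasurable W volume ∧
    Tendsto W atTop (nhds 0) ∧
    (∫⁻ t in Ioi (0:ℝ), ENNReal.ofReal (W t)) = ∞ ∧
    (∫⁻ t in Ioc (0:ℝ) 1, ENNReal.ofReal (W t)) < ∞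

/-- The Garling function norm
`ρ_G(f) = sup over E, F ⊆ (0,∞) and MO-isomorphisms m : E → F of (∫_E f(m t)^p W(t) dt)^{1/p}`. -/
noncomputable def rhoG (p : ℝ) (W : ℝ → ℝ) (f : ℝ → ℝ≥0∞) : ℝ≥0∞ :=
  ⨆ (E : Set ℝ) (F : Set ℝ) (m : ℝ → ℝ) (_ : E ⊆ Ioi 0) (_ : F ⊆ Ioi 0)
    (_ : NullMeasurableSet E volume) (_ : NullMeasurableSet F volume) (_ : MOIso E F m),
    (∫⁻ t in E, f (m t) ^ p * ENNReal.ofReal (W t)) ^ (1 / p)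

lemma eq_of_mem_Ioc_natCast {k l : ℕ} {t : ℝ} (hk : t ∈ Ioc (k : ℝ) (k + 1))
    (hl : t ∈ Ioc (l : ℝ) (l + 1)) : k = l := by
  have h₁ : (k : ℝ) < l + 1 := hk.1.trans_le hl.2
  have h₂ : (l : ℝ) < k + 1 := hl.1.trans_le hk.2
  norm_cast at h₁ h₂
  omega

lemma exists_mem_Ioc_natCast {t : ℝ} (ht : t ∈ Ioi (0 : ℝ)) :
    ∃ k : ℕ, t ∈ Ioc (k : ℝ) (k + 1) := by
  obtain ⟨k, hk⟩ := Nat.exists_eq_succ_of_ne_zero (Nat.ceil_pos.2 (mem_Ioi.1 ht)).ne'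
  refine ⟨k, Nat.lt_ceil.1 (by omega), ?_⟩
  have := Nat.le_ceil t
  rw [hk] at this
  exact_mod_cast this

lemma MOIso.comp {E F G : Set ℝ} {m n : ℝ → ℝ} (hn : MOIso F G n) (hm : MOIso E F m) :
    MOIso E G (n ∘ m) where
  bijOn := hn.bijOn.comp hm.bijOn
  strictMonoOn := hn.strictMonoOn.comp hm.strictMonoOn hm.bijOn.mapsTo
  measPres A hA hAm := by
    obtain ⟨h₁, h₂⟩ := hn.measPres A hA hAm
    obtain ⟨h₃, h₄⟩ := hm.measPres _ inter_subset_left h₁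
    have h_eq : E ∩ (n ∘ m) ⁻¹' A = E ∩ m ⁻¹' (F ∩ n ⁻¹' A) := by
      ext x
      exact ⟨fun h => ⟨h.1, hm.bijOn.mapsTo h.1, h.2⟩, fun h => ⟨h.1, h.2.2⟩⟩
    rw [h_eq]
    exact ⟨h₃, h₄.trans h₂⟩
  invMeasPres B hB hBm := by
    obtain ⟨h₁, h₂⟩ := hm.invMeasPres B hB hBm
    obtain ⟨h₃, h₄⟩ := hn.invMeasPres _ ((image_mono hB).trans hm.bijOn.image_eq.subset) h₁
    rw [image_comp]
    exact ⟨h₃, h₄.trans h₂⟩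

lemma MOIso.restrict {E F B : Set ℝ} {m : ℝ → ℝ} (hm : MOIso E F m) (hB : B ⊆ E) :
    MOIso B (m '' B) m where
  bijOn := (hm.bijOn.injOn.mono hB).bijOn_image
  strictMonoOn := hm.strictMonoOn.mono hB
  measPres A hA hAm := by
    have hAF : A ⊆ F := hA.trans ((image_mono hB).trans hm.bijOn.image_eq.subset)
    have h_eq : B ∩ m ⁻¹' A = E ∩ m ⁻¹' A := by
      ext x
      refine ⟨fun h => ⟨hB h.1, h.2⟩, fun h => ⟨?_, h.2⟩⟩
      obtain ⟨y, hy, hyx⟩ := hA h.2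
      exact hm.bijOn.injOn (hB hy) h.1 hyx ▸ hy
    rw [h_eq]
    exact hm.measPres A hAF hAm
  invMeasPres C hC hCm := hm.invMeasPres C (hC.trans hB) hCm

lemma MOIso.symm {E F : Set ℝ} {m : ℝ → ℝ} (hm : MOIso E F m) :
    MOIso F E (Function.invFunOn m E) := by
  have hinv : InvOn (Function.invFunOn m E) m E F := hm.bijOn.invOn_invFunOn
  have hbij : BijOn (Function.invFunOn m E) F E := hm.bijOn.symm hinv.symm
  refine ⟨hbij, ?_, ?_, ?_⟩
  · intro x hx y hy hxy
    rwa [← hm.strictMonoOn.lt_iff_lt (hbij.mapsTo hx) (hbij.mapsTo hy), hinv.2 hx, hinv.2 hy]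
  · intro A hA hAm
    have h_eq : F ∩ Function.invFunOn m E ⁻¹' A = m '' A := by
      ext x
      constructor
      · rintro ⟨hx, hxA⟩
        exact ⟨_, hxA, hinv.2 hx⟩
      · rintro ⟨y, hy, rfl⟩
        refine ⟨hm.bijOn.mapsTo (hA hy), ?_⟩
        rw [mem_preimage, hinv.1 (hA hy)]
        exact hy
    rw [h_eq]
    exact hm.invMeasPres A hA hAm
  · intro B hB hBm
    have h_eq : Function.invFunOn m E '' B = E ∩ m ⁻¹' B := by
      ext x
      constructor
      · rintro ⟨y, hy, rfl⟩
        refine ⟨hbij.mapsTo (hB hy), ?_⟩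
        rw [mem_preimage, hinv.2 (hB hy)]
        exact hy
      · rintro ⟨hx, hxB⟩
        exact ⟨_, hxB, hinv.1 hx⟩
    rw [h_eq]
    exact hm.measPres B hB hBm

lemma le_rhoG {p : ℝ} {W : ℝ → ℝ} {f : ℝ → ℝ≥0∞} {E F : Set ℝ} {m : ℝ → ℝ}
    (hE : E ⊆ Ioi 0) (hF : F ⊆ Ioi 0) (hEm : NullMeasurableSet E volume)
    (hFm : NullMeasurableSet F volume) (hm : MOIso E F m) :
    (∫⁻ t in E, f (m t) ^ p * ENNReal.ofReal (W t)) ^ (1 / p) ≤ rhoG p W f :=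
  le_iSup_of_le E <| le_iSup_of_le F <| le_iSup_of_le m <| le_iSup_of_le hE <|
    le_iSup_of_le hF <| le_iSup_of_le hEm <| le_iSup_of_le hFm <| le_iSup_of_le hm le_rfl

lemma setLIntegral_congr_of_nullMeasurableSet {E : Set ℝ} (hE : NullMeasurableSet E volume)
    {u v : ℝ → ℝ≥0∞} (h : ∀ t ∈ E, u t = v t) : ∫⁻ t in E, u t = ∫⁻ t in E, v t :=
  lintegral_congr_ae ((ae_restrict_iff'₀ hE).2 (ae_of_all _ h))

/-- The Garling norm is invariant under transport along an MO-isomorphism of `(0,∞)` onto a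
subset carrying the transported function. -/
lemma rhoG_eq_of_MOIso {p : ℝ} (hp : 0 < p) (W : ℝ → ℝ) {f g : ℝ → ℝ≥0∞} {S : Set ℝ}
    {ψ : ℝ → ℝ} (hψ : MOIso (Ioi 0) S ψ) (hS : S ⊆ Ioi 0)
    (hfg : ∀ t ∈ Ioi (0 : ℝ), f (ψ t) = g t) (hf : ∀ t ∉ S, f t = 0) :
    rhoG p W f = rhoG p W g := by
  have hSm : NullMeasurableSet S volume := by
    rw [← hψ.bijOn.image_eq]
    exact (hψ.invMeasPres _ Subset.rfl measurableSet_Ioi.nullMeasurableSet).1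
  apply le_antisymm
  · refine iSup_le fun E => iSup_le fun F => iSup_le fun m => iSup_le fun hE => iSup_le fun hF =>
      iSup_le fun hEm => iSup_le fun hFm => iSup_le fun hm => ?_
    set E' := E ∩ m ⁻¹' (F ∩ S)
    have hE'm : NullMeasurableSet E' volume :=
      (hm.measPres _ inter_subset_left (hFm.inter hSm)).1
    have hres : MOIso E' (m '' E') m := hm.restrict inter_subset_left
    have hS' : m '' E' ⊆ S := by
      rintro _ ⟨x, hx, rfl⟩
      exact hx.2.2
    have hS'm : NullMeasurableSet (m '' E') volume :=
      (hm.invMeasPres _ inter_subset_left hE'm).1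
    have hres' := hψ.symm.restrict hS'
    have hG : Function.invFunOn ψ (Ioi 0) '' (m '' E') ⊆ Ioi 0 :=
      (image_mono hS').trans hψ.symm.bijOn.image_eq.subset
    refine le_trans ?_ (le_rhoG (inter_subset_left.trans hE) hG hE'm
      (hψ.symm.invMeasPres _ hS' hS'm).1 (hres'.comp hres))
    refine ENNReal.rpow_le_rpow ?_ (by positivity)
    have hzero : ∫⁻ t in E \ E', f (m t) ^ p * ENNReal.ofReal (W t) = 0 := by
      rw [setLIntegral_congr_of_nullMeasurableSet (v := fun _ => 0) (hEm.diff hE'm),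
        lintegral_zero]
      intro t ht
      have hmt : m t ∉ S := fun h => ht.2 ⟨ht.1, hm.bijOn.mapsTo ht.1, h⟩
      rw [hf _ hmt, ENNReal.zero_rpow_of_pos hp, zero_mul]
    calc ∫⁻ t in E, f (m t) ^ p * ENNReal.ofReal (W t)
        = ∫⁻ t in E' ∪ E \ E', f (m t) ^ p * ENNReal.ofReal (W t) := by
          rw [union_sdiff_cancel inter_subset_left]
      _ ≤ (∫⁻ t in E', f (m t) ^ p * ENNReal.ofReal (W t)) +
            ∫⁻ t in E \ E', f (m t) ^ p * ENNReal.ofReal (W t) := lintegral_union_le _ _ _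
      _ = ∫⁻ t in E', f (m t) ^ p * ENNReal.ofReal (W t) := by rw [hzero, add_zero]
      _ ≤ _ := by
          refine (setLIntegral_congr_of_nullMeasurableSet hE'm fun t ht => ?_).le
          rw [Function.comp_apply, ← hfg _ (hψ.symm.bijOn.mapsTo ht.2.2),
            hψ.bijOn.invOn_invFunOn.2 ht.2.2]
  · refine iSup_le fun E => iSup_le fun F => iSup_le fun m => iSup_le fun hE => iSup_le fun hF =>
      iSup_le fun hEm => iSup_le fun hFm => iSup_le fun hm => ?_
    have hψF : ψ '' F ⊆ Ioi 0 :=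
      ((image_mono hF).trans hψ.bijOn.image_eq.subset).trans hS
    refine le_trans (le_of_eq ?_) (le_rhoG hE hψF hEm (hψ.invMeasPres _ hF hFm).1
      ((hψ.restrict hF).comp hm))
    congr 1
    refine setLIntegral_congr_of_nullMeasurableSet hEm fun t ht => ?_
    rw [Function.comp_apply, hfg _ (hF (hm.bijOn.mapsTo ht))]

/-- A strictly increasing map that is a translation on each of the intervals `(k, k+1]`, `k ∈ ℕ`,
is an MO-isomorphism of `(0,∞)` onto its image. -/
lemma MOIso.of_translation {ψ : ℝ → ℝ} {c : ℕ → ℝ} (hmono : StrictMonoOn ψ (Ioi 0))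
    (hψ : ∀ k : ℕ, ∀ t ∈ Ioc (k : ℝ) (k + 1), ψ t = t + c k) :
    MOIso (Ioi 0) (ψ '' Ioi 0) ψ := by
  have hpos : ∀ k : ℕ, Ioc (k : ℝ) (k + 1) ⊆ Ioi 0 :=
    fun k t ht => (Nat.cast_nonneg k).trans_lt ht.1
  have hdisj : Pairwise (Function.onFun Disjoint fun k : ℕ => Ioc (k : ℝ) (k + 1)) :=
    fun k l hkl => Set.disjoint_left.2 fun t hk hl => hkl (eq_of_mem_Ioc_natCast hk hl)
  have himage : ∀ B : Set ℝ, B ⊆ Ioi 0 → NullMeasurableSet B volume →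
      NullMeasurableSet (ψ '' B) volume ∧ volume (ψ '' B) = volume B := by
    intro B hB hBm
    have hB_eq : B = ⋃ k : ℕ, B ∩ Ioc (k : ℝ) (k + 1) := by
      rw [← inter_iUnion, eq_comm, inter_eq_left]
      exact fun t ht => mem_iUnion.2 (exists_mem_Ioc_natCast (hB ht))
    have hpiece : ∀ k : ℕ, ψ '' (B ∩ Ioc (k : ℝ) (k + 1)) =
        (fun t => t + -c k) ⁻¹' (B ∩ Ioc (k : ℝ) (k + 1)) := by
      intro k
      rw [image_congr fun t ht => hψ k t ht.2, image_add_right]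
    have hpm : ∀ k : ℕ, NullMeasurableSet (B ∩ Ioc (k : ℝ) (k + 1)) volume :=
      fun k => hBm.inter measurableSet_Ioc.nullMeasurableSet
    have him : ∀ k : ℕ, NullMeasurableSet (ψ '' (B ∩ Ioc (k : ℝ) (k + 1))) volume := by
      intro k
      rw [hpiece]
      exact (hpm k).preimage (measurePreserving_add_right volume _).quasiMeasurePreserving
    have hψB : ψ '' B = ⋃ k : ℕ, ψ '' (B ∩ Ioc (k : ℝ) (k + 1)) := by
      rw [← image_iUnion, ← hB_eq]
    refine ⟨hψB ▸ NullMeasurableSet.iUnion him, ?_⟩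
    have hBd : Pairwise (Function.onFun Disjoint fun k : ℕ => B ∩ Ioc (k : ℝ) (k + 1)) :=
      fun k l hkl => (hdisj hkl).mono inter_subset_right inter_subset_right
    have hψd : Pairwise (Function.onFun Disjoint fun k : ℕ => ψ '' (B ∩ Ioc (k : ℝ) (k + 1))) :=
      fun k l hkl => disjoint_image_image fun x hx y hy hxy => Set.disjoint_left.1 (hBd hkl) hx
        (hmono.injOn (hB hx.1) (hB hy.1) hxy ▸ hy)
    rw [hψB, measure_iUnion₀ (fun k l hkl => (hψd hkl).aedisjoint) him]
    conv_rhs => rw [hB_eq, measure_iUnion₀ (fun k l hkl => (hBd hkl).aedisjoint) hpm]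
    refine tsum_congr fun k => ?_
    rw [hpiece, measure_preimage_add_right]
  refine ⟨hmono.injOn.bijOn_image, hmono, fun A hA hAm => ?_, himage⟩
  have h_eq : Ioi 0 ∩ ψ ⁻¹' A =
      ⋃ k : ℕ, Ioc (k : ℝ) (k + 1) ∩ (fun t => t + c k) ⁻¹' A := by
    ext t
    simp only [mem_inter_iff, mem_iUnion, mem_preimage]
    constructor
    · rintro ⟨ht, htA⟩
      obtain ⟨k, hk⟩ := exists_mem_Ioc_natCast ht
      exact ⟨k, hk, hψ k t hk ▸ htA⟩
    · rintro ⟨k, hk, htA⟩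
      exact ⟨hpos k hk, (hψ k t hk).symm ▸ htA⟩
  have hm : NullMeasurableSet (Ioi 0 ∩ ψ ⁻¹' A) volume := by
    rw [h_eq]
    exact NullMeasurableSet.iUnion fun k => measurableSet_Ioc.nullMeasurableSet.inter
      (hAm.preimage (measurePreserving_add_right volume _).quasiMeasurePreserving)
  refine ⟨hm, ?_⟩
  rw [← (himage _ inter_subset_left hm).2, image_inter_preimage, inter_eq_right.2 hA]

/-- For `1 ≤ p < ∞` and `W ∈ 𝕎`, the sequence of indicator functions
`1_i = 1_{(i-1,i]}` (here indexed by `i ∈ ℕ` as `1_{(i,i+1]}`) is 1-subsymmetric in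
`G_{W,p}(0,∞)`: passing to a subsequence preserves the norm. -/
theorem stmt11 (p : ℝ) (hp : 1 ≤ p) (W : ℝ → ℝ) (hW : memW W)
    (a : ℕ → ℝ) (ha : (Function.support a).Finite)
    (i : ℕ → ℕ) (hi : StrictMono i) :
    rhoG p W (fun t => ENNReal.ofReal
        |∑' k : ℕ, (Ioc (i k : ℝ) (i k + 1)).indicator (fun _ => a k) t|) =
    rhoG p W (fun t => ENNReal.ofReal
        |∑' k : ℕ, (Ioc (k : ℝ) (k + 1)).indicator (fun _ => a k) t|) := by
  set ψ : ℝ → ℝ := fun t => t + ((i (⌈t⌉₊ - 1) : ℝ) - (⌈t⌉₊ - 1 : ℕ)) with hψ_def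
  have hψ : ∀ k : ℕ, ∀ t ∈ Ioc (k : ℝ) (k + 1), ψ t = t + ((i k : ℝ) - k) := by
    intro k t ht
    have hceil : ⌈t⌉₊ - 1 = k := by
      rw [(Nat.ceil_eq_iff (n := k + 1) (by omega)).2 (by simpa using ht), Nat.add_sub_cancel]
    rw [hψ_def]
    simp only [hceil]
  have hgap : Monotone fun k : ℕ => (i k : ℝ) - k := by
    refine monotone_nat_of_le_succ fun k => ?_
    have h : ((i k + 1 : ℕ) : ℝ) ≤ i (k + 1) := Nat.cast_le.2 (hi k.lt_succ_self)
    push_cast at h ⊢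
    linarith
  have hmono : StrictMonoOn ψ (Ioi 0) := fun s _ t _ hst =>
    add_lt_add_of_lt_of_le hst (hgap (Nat.sub_le_sub_right (Nat.ceil_mono hst.le) 1))
  have hmaps : ∀ k : ℕ, ∀ t ∈ Ioc (k : ℝ) (k + 1), ψ t ∈ Ioc (i k : ℝ) (i k + 1) := by
    intro k t ht
    rw [hψ k t ht]
    constructor <;> linarith [ht.1, ht.2]
  refine rhoG_eq_of_MOIso (zero_lt_one.trans_le hp) W (MOIso.of_translation hmono hψ) ?_ ?_ ?_
  · rintro _ ⟨t, ht, rfl⟩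
    obtain ⟨n, hn⟩ := exists_mem_Ioc_natCast ht
    exact (Nat.cast_nonneg _).trans_lt (hmaps n t hn).1
  · intro t ht
    obtain ⟨n, hn⟩ := exists_mem_Ioc_natCast ht
    congr 2
    refine tsum_congr fun k => ?_
    have hiff : ψ t ∈ Ioc (i k : ℝ) (i k + 1) ↔ t ∈ Ioc (k : ℝ) (k + 1) := by
      refine ⟨fun h => ?_, hmaps k t⟩
      rwa [hi.injective (eq_of_mem_Ioc_natCast h (hmaps n t hn))]
    simp only [indicator_apply, hiff]
  · intro t ht
    have hzero : ∀ k, (Ioc (i k : ℝ) (i k + 1)).indicator (fun _ => a k) t = 0 := by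
      refine fun k => indicator_of_notMem (fun h => ht ?_) _
      have hk : t - (i k - k) ∈ Ioc (k : ℝ) (k + 1) := by
        constructor <;> linarith [h.1, h.2]
      exact ⟨_, (Nat.cast_nonneg k).trans_lt hk.1, by rw [hψ k _ hk]; ring⟩
    simp [hzero]
end

section
/- Fix 1 ≤ p < ∞ and W ∈ 𝕎, and write 1_i for the indicator function of (i-1, i] for i ∈ ℕ. Then for every N ∈ ℕ, ρ_G(∑_{i=1}^N 1_i)^p = ∫_0^N W(t) dt; that is, the sequence (1_i) is, for constant coefficients, isometrically equivalent to the unit vector basis of the Garling sequence space g(w,p) with weights w(k) = ∫_{k-1}^k W(t) dt. -/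
open MeasureTheory Set ENNReal Filter

/-- Among subsets of `(0, ∞)` of measure at most `a`, the interval `(0, a]` maximizes the integral
of a nonincreasing function. -/
theorem setLIntegral_le_setLIntegral_Ioc_of_antitoneOn {g : ℝ → ℝ≥0∞} {S : Set ℝ} {a : ℝ}
    (hg : AntitoneOn g (Ioi 0)) (hS : NullMeasurableSet S volume) (hS0 : S ⊆ Ioi 0) (ha : 0 ≤ a)
    (hSa : volume S ≤ ENNReal.ofReal a) : ∫⁻ t in S, g t ≤ ∫⁻ t in Ioc 0 a, g t := by
  rcases ha.eq_or_lt with rfl | ha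
  · have h : volume S = 0 := by simpa using hSa
    simp [Measure.restrict_eq_zero.2 h]
  have hA : NullMeasurableSet (Ioc 0 a) volume := measurableSet_Ioc.nullMeasurableSet
  have hvol : volume (S \ Ioc 0 a) ≤ volume (Ioc 0 a \ S) := by
    have hfin : volume (S ∩ Ioc 0 a) ≠ ∞ :=
      ((measure_mono inter_subset_left).trans_lt (hSa.trans_lt ofReal_lt_top)).ne
    refine (ENNReal.add_le_add_iff_left hfin).1 ?_
    rw [measure_inter_add_sdiff₀ S hA, inter_comm, measure_inter_add_sdiff₀ _ hS]
    simpa using hSa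
  have hle : ∫⁻ t in S \ Ioc 0 a, g t ≤ ∫⁻ _ in S \ Ioc 0 a, g a := by
    refine lintegral_mono_ae ?_
    filter_upwards [ae_restrict_mem₀ (hS.diff hA)] with t ht
    have ht0 : 0 < t := hS0 ht.1
    exact hg ha ht0 (le_of_not_ge fun h => ht.2 ⟨ht0, h⟩)
  have hge : ∫⁻ _ in Ioc 0 a \ S, g a ≤ ∫⁻ t in Ioc 0 a \ S, g t := by
    refine lintegral_mono_ae ?_
    filter_upwards [ae_restrict_mem₀ (hA.diff hS)] with t ht
    exact hg ht.1.1 ha ht.1.2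
  rw [setLIntegral_const] at hle hge
  calc ∫⁻ t in S, g t = (∫⁻ t in S ∩ Ioc 0 a, g t) + ∫⁻ t in S \ Ioc 0 a, g t := by
        rw [← lintegral_add_measure, Measure.restrict_inter_add_sdiff₀ S hA]
    _ ≤ (∫⁻ t in S ∩ Ioc 0 a, g t) + ∫⁻ t in Ioc 0 a \ S, g t :=
        add_le_add le_rfl (hle.trans (le_trans (by gcongr) hge))
    _ = ∫⁻ t in Ioc 0 a, g t := by
        rw [inter_comm, ← lintegral_add_measure, Measure.restrict_inter_add_sdiff₀ _ hS]

/-- The indicators of `(0, 1], …, (N - 1, N]` sum to the indicator of `(0, N]`. -/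
theorem sum_indicator_Ioc_natCast (N : ℕ) (t : ℝ) :
    ∑ i ∈ Finset.range N, (Ioc (i : ℝ) (i + 1)).indicator (fun _ => (1 : ℝ≥0∞)) t =
      (Ioc (0 : ℝ) N).indicator (fun _ => 1) t := by
  induction N with
  | zero => simp
  | succ n ih =>
    have hn : (0 : ℝ) ≤ n := n.cast_nonneg
    rw [Finset.sum_range_succ, ih, Nat.cast_succ,
      ← Ioc_union_Ioc_eq_Ioc hn (by linarith : (n : ℝ) ≤ n + 1),
      indicator_union_of_disjoint (Ioc_disjoint_Ioc_of_le le_rfl)]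

/-- The identity is an MO-isomorphism from any set to itself. -/
theorem MOIso.refl (E : Set ℝ) : MOIso E E id where
  bijOn := bijOn_id E
  strictMonoOn := strictMono_id.strictMonoOn E
  measPres A hA hAm := by
    rw [preimage_id, inter_eq_right.2 hA]
    exact ⟨hAm, rfl⟩
  invMeasPres B _ hBm := by simpa using hBm

/-- For `1 ≤ p < ∞`, `W ∈ 𝕎` and every `N ∈ ℕ`,
`ρ_G(∑_{i=1}^N 1_i)^p = ∫_0^N W(t) dt` (with `1_i = 1_{(i-1,i]}`, here indexed from `0` as
`1_{(i,i+1]}`); i.e. for constant coefficients `(1_i)` is isometrically equivalent to the unit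
vector basis of the Garling sequence space with weights `w(k) = ∫_{k-1}^k W`. -/
theorem stmt13 (p : ℝ) (hp : 1 ≤ p) (W : ℝ → ℝ) (hW : memW W) (N : ℕ) :
    (rhoG p W (fun t =>
        ∑ i ∈ Finset.range N, (Ioc (i : ℝ) (i + 1)).indicator (fun _ => (1 : ℝ≥0∞)) t)) ^ p =
      ∫⁻ t in Ioc (0 : ℝ) (N : ℝ), ENNReal.ofReal (W t) := by
  have hp0 : 0 < p := by linarith
  have hg : AntitoneOn (fun t => ENNReal.ofReal (W t)) (Ioi 0) :=
    fun _ hx _ hy hxy => ENNReal.ofReal_le_ofReal (hW.1 hx hy hxy)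
  have hpow (t w) : (Ioc (0 : ℝ) N).indicator (fun _ => (1 : ℝ≥0∞)) t ^ p * w =
      (Ioc (0 : ℝ) N).indicator (fun _ => w) t := by
    by_cases ht : t ∈ Ioc (0 : ℝ) N <;> simp [ht, hp0]
  suffices h : rhoG p W (fun t =>
      ∑ i ∈ Finset.range N, (Ioc (i : ℝ) (i + 1)).indicator (fun _ => (1 : ℝ≥0∞)) t) =
      (∫⁻ t in Ioc (0 : ℝ) (N : ℝ), ENNReal.ofReal (W t)) ^ (1 / p) by
    rw [h, ← ENNReal.rpow_mul, one_div_mul_cancel hp0.ne', ENNReal.rpow_one]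
  simp only [rhoG, sum_indicator_Ioc_natCast, hpow]
  apply le_antisymm
  · simp only [iSup_le_iff]
    intro E F m hE hF hEm hFm hm
    refine ENNReal.rpow_le_rpow ?_ (by positivity)
    obtain ⟨hSm, hSv⟩ := hm.measPres (F ∩ Ioc 0 N) inter_subset_left
      (hFm.inter measurableSet_Ioc.nullMeasurableSet)
    set S := E ∩ m ⁻¹' (F ∩ Ioc 0 N)
    calc ∫⁻ t in E, (Ioc (0 : ℝ) N).indicator (fun _ => ENNReal.ofReal (W t)) (m t)
        ≤ ∫⁻ t in E, S.indicator (fun t => ENNReal.ofReal (W t)) t := by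
          refine lintegral_mono_ae ?_
          filter_upwards [ae_restrict_mem₀ hEm] with t ht
          by_cases h : m t ∈ Ioc (0 : ℝ) N
          · have hmem : t ∈ S := ⟨ht, hm.bijOn.mapsTo ht, h⟩
            rw [indicator_of_mem h, indicator_of_mem hmem]
          · rw [indicator_of_notMem h]
            exact zero_le
      _ ≤ ∫⁻ t, S.indicator (fun t => ENNReal.ofReal (W t)) t := setLIntegral_le_lintegral _ _
      _ ≤ ∫⁻ t in S, ENNReal.ofReal (W t) := lintegral_indicator_le _ _
      _ ≤ ∫⁻ t in Ioc (0 : ℝ) N, ENNReal.ofReal (W t) := by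
          refine setLIntegral_le_setLIntegral_Ioc_of_antitoneOn hg hSm
            (inter_subset_left.trans hE) N.cast_nonneg ?_
          rw [hSv]
          exact (measure_mono inter_subset_right).trans (by simp)
  · have hI : NullMeasurableSet (Ioi (0 : ℝ)) volume := measurableSet_Ioi.nullMeasurableSet
    refine le_iSup₂_of_le (Ioi 0) (Ioi 0) <| le_iSup₂_of_le id Subset.rfl <|
      le_iSup₂_of_le Subset.rfl hI <| le_iSup₂_of_le hI (MOIso.refl _) ?_
    refine ENNReal.rpow_le_rpow ?_ (by positivity)
    rw [← lintegral_indicator measurableSet_Ioc, ← lintegral_indicator measurableSet_Ioi]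
    refine lintegral_mono fun t => ?_
    by_cases ht : t ∈ Ioc (0 : ℝ) N
    · have ht0 : t ∈ Ioi (0 : ℝ) := ht.1
      simp only [id, indicator_of_mem ht, indicator_of_mem ht0, le_refl]
    · simp [indicator_of_notMem ht]
end
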